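/- Let p be a prime and let G = Z_p ⋊_φ H where H is abelian and φ satisfies property (⋆). Let D ⊆ G be a finite set with π_2(d) ∈ H_1 for every d ∈ D, and let D = D^o ∪ D^e be a partition with |D^o| ∈ {|D^e|, |D^e| + 1}. Then the alternating product d_1^o · d_1^e · d_2^o · d_2^e ⋯ (which places the elements of D^o in the odd positions and the elements of D^e in the even positions, using every element of D exactly once) takes the same value in G for every choice of ordering of D^o and every choice of ordering of D^e. -/

import Mathlib

open scoped Classical

/-- The partial products `p_i = l_1 ⋯ l_i` for `1 ≤ i ≤ n` are pairwise distinct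
(valid ordering) and moreover `p_i ≠ 1` for `1 ≤ i ≤ n-1`. -/
def IsSequencing {G : Type*} [Group G] (l : List G) : Prop :=
  (∀ i ∈ Finset.Icc 1 l.length, ∀ j ∈ Finset.Icc 1 l.length,
    (l.take i).prod = (l.take j).prod → i = j) ∧
  ∀ i ∈ Finset.Ico 1 l.length, (l.take i).prod ≠ 1

/-- `l` is a sequencing of the finite set `A`. -/
def IsSequencingOf {G : Type*} [Group G] (l : List G) (A : Finset G) : Prop :=
  l.Nodup ∧ l.toFinset = A ∧ IsSequencing l

/-- Every finite subset of `G \ {1}` is sequenceable. -/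
def StronglySequenceable (G : Type*) [Group G] : Prop :=
  ∀ A : Finset G, (1 : G) ∉ A → ∃ l : List G, IsSequencingOf l A

/-- Property (⋆): every `φ h` is the identity or the negation automorphism of `ℤ/p`. -/
def PropertyStar {p : ℕ} {H : Type*} [Group H]
    (φ : H →* MulAut (Multiplicative (ZMod p))) : Prop :=
  ∀ h : H, φ h = 1 ∨ φ h = MulEquiv.inv (Multiplicative (ZMod p))

/-- `interleave l₁ l₂` alternates the two lists, starting with `l₁`: the elements of
`l₁` occupy the odd positions and the elements of `l₂` the even positions. -/
def interleave {α : Type*} : List α → List α → List α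
  | [], l => l
  | a :: l, l' => a :: interleave l' l
termination_by l₁ l₂ => l₁.length + l₂.length
decreasing_by simp; omega

theorem right_prod_interleave {N H : Type*} [Group N] [CommGroup H] {φ : H →* MulAut N}
    (l l' : List (N ⋊[φ] H)) :
    (interleave l l').prod.right =
      (l.map SemidirectProduct.right).prod * (l'.map SemidirectProduct.right).prod := by
  induction l, l' using interleave.induct with
  | case1 l => simpa [interleave] using map_list_prod (SemidirectProduct.rightHom (φ := φ)) l
  | case2 a l l' ih =>
    rw [interleave, List.prod_cons, SemidirectProduct.mul_right, ih]
    simp only [List.map_cons, List.prod_cons]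
    rw [mul_assoc, mul_comm (List.prod (l.map _))]

/-- When every right component acts by inversion, the left component of an alternating product
is the product of the odd left components divided by that of the even ones. -/
theorem left_prod_interleave {N H : Type*} [CommGroup N] [Group H] {φ : H →* MulAut N}
    (l l' : List (N ⋊[φ] H)) (hlen : l.length = l'.length ∨ l.length = l'.length + 1)
    (hl : ∀ d ∈ l, φ d.right = MulEquiv.inv N) (hl' : ∀ d ∈ l', φ d.right = MulEquiv.inv N) :
    (interleave l l').prod.left =
      (l.map SemidirectProduct.left).prod / (l'.map SemidirectProduct.left).prod := by
  induction l, l' using interleave.induct with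
  | case1 l =>
    obtain rfl : l = [] := List.length_eq_zero_iff.mp (by simp at hlen; simp [hlen])
    simp [interleave]
  | case2 a l l' ih =>
    have hlen' : l'.length = l.length ∨ l'.length = l.length + 1 := by
      simp only [List.length_cons] at hlen
      omega
    rw [interleave, List.prod_cons, SemidirectProduct.mul_left, hl a (by simp),
      ih hlen' hl' fun d hd => hl d (by simp [hd])]
    simp [mul_div_assoc]

/-- if every element of `D = D^o ∪ D^e` has its `H`-component in `H₁` and
`|D^o| ∈ {|D^e|, |D^e| + 1}`, then the alternating product (elements of `D^o` in odd
positions, elements of `D^e` in even positions) is independent of the orderings chosen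
on `D^o` and on `D^e`. -/
theorem statement9 (p : ℕ) (hp : p.Prime) (H : Type*) [CommGroup H]
    (φ : H →* MulAut (Multiplicative (ZMod p))) (hφ : PropertyStar φ)
    (Do De : Finset (Multiplicative (ZMod p) ⋊[φ] H)) (hdisj : Disjoint Do De)
    (hmem : ∀ d ∈ Do ∪ De,
      φ (SemidirectProduct.right d) = MulEquiv.inv (Multiplicative (ZMod p)))
    (hcard : Do.card = De.card ∨ Do.card = De.card + 1) :
    ∀ lo₁ le₁ lo₂ le₂ : List (Multiplicative (ZMod p) ⋊[φ] H),
      lo₁.Nodup → lo₁.toFinset = Do → le₁.Nodup → le₁.toFinset = De →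
      lo₂.Nodup → lo₂.toFinset = Do → le₂.Nodup → le₂.toFinset = De →
      (interleave lo₁ le₁).prod = (interleave lo₂ le₂).prod := by
  intro lo₁ le₁ lo₂ le₂ ho₁ ho₁' he₁ he₁' ho₂ ho₂' he₂ he₂'
  have ho : lo₁.Perm lo₂ := List.perm_of_nodup_nodup_toFinset_eq ho₁ ho₂ (ho₁'.trans ho₂'.symm)
  have he : le₁.Perm le₂ := List.perm_of_nodup_nodup_toFinset_eq he₁ he₂ (he₁'.trans he₂'.symm)
  have hlen : lo₁.length = le₁.length ∨ lo₁.length = le₁.length + 1 := by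
    rwa [← ho₁', ← he₁', List.toFinset_card_of_nodup ho₁, List.toFinset_card_of_nodup he₁] at hcard
  have hmemo : ∀ d ∈ lo₁, φ d.right = MulEquiv.inv _ := fun d hd =>
    hmem d (Finset.mem_union_left _ (by simpa [← ho₁'] using hd))
  have hmeme : ∀ d ∈ le₁, φ d.right = MulEquiv.inv _ := fun d hd =>
    hmem d (Finset.mem_union_right _ (by simpa [← he₁'] using hd))
  apply SemidirectProduct.ext
  · rw [left_prod_interleave lo₁ le₁ hlen hmemo hmeme,
      left_prod_interleave lo₂ le₂ (by rwa [← ho.length_eq, ← he.length_eq])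
        (fun d hd => hmemo d (ho.mem_iff.mpr hd)) (fun d hd => hmeme d (he.mem_iff.mpr hd)),
      (ho.map _).prod_eq, (he.map _).prod_eq]
  · rw [right_prod_interleave, right_prod_interleave, (ho.map _).prod_eq, (he.map _).prod_eq]
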